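/- Let c be a nonempty list of integers with every entry ≥ 2. Then the following are equivalent: (1) s(c) is a multiple of 4; (2) [4]_q = q³ + q² + q + 1 divides 𝓢(c) in ℤ[q]; (3) q² + 1 divides 𝓢(c) in ℤ[q]. -/

import Mathlib

open Polynomial

/-- The `q`-deformation `[n]_q = 1 + q + ⋯ + q^{n-1}` of a nonnegative integer. -/
noncomputable def qNat (n : ℕ) : Polynomial ℤ := (Finset.range n).sum fun i => X ^ i

/-- The matrix `M_q⁻(c) = (([c]_q, -q^{c-1}), (1, 0))` over `ℤ[q]`. -/
noncomputable def MqNeg (c : ℕ) : Matrix (Fin 2) (Fin 2) (Polynomial ℤ) :=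
  !![qNat c, -(X ^ (c - 1)); 1, 0]

/-- `𝓡(c)`: the (0,0) entry of `M_q⁻(c₁)⋯M_q⁻(c_l)`. -/
noncomputable def Rpoly (L : List ℕ) : Polynomial ℤ := ((L.map MqNeg).prod) 0 0

/-- `𝓢(c)`: the (1,0) entry of `M_q⁻(c₁)⋯M_q⁻(c_l)`. -/
noncomputable def Spoly (L : List ℕ) : Polynomial ℤ := ((L.map MqNeg).prod) 1 0

/-- `r(c) = 𝓡(c)(1)`. -/
noncomputable def rNum (L : List ℕ) : ℤ := (Rpoly L).eval 1

/-- `s(c) = 𝓢(c)(1)`. -/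
noncomputable def sNum (L : List ℕ) : ℤ := (Spoly L).eval 1

/-- Up to a unit `u`, the pair `(r, s)` is `(1, 0)`, `([d]_q, 1)` or `(q, 1 + q)`. -/
def IsMarkedPair {A : Type*} [CommRing A] (q r s : A) : Prop :=
  ∃ u : A, IsUnit u ∧ ((r = u ∧ s = 0) ∨
    (∃ d : ℕ, r = u * ∑ i ∈ Finset.range d, q ^ i ∧ s = u) ∨ (r = u * q ∧ s = u * (1 + q)))

section Orbit

variable {A : Type*} [CommRing A] {q : A}

lemma pow_four_eq_one_of_geom_sum (hq : 1 + q + q ^ 2 + q ^ 3 = 0) : q ^ 4 = 1 := by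
  linear_combination (q - 1) * hq

lemma isUnit_of_geom_sum (hq : 1 + q + q ^ 2 + q ^ 3 = 0) : IsUnit q :=
  IsUnit.of_mul_eq_one (q ^ 3) (by linear_combination pow_four_eq_one_of_geom_sum hq)

lemma geom_sum_mod_four (hq : 1 + q + q ^ 2 + q ^ 3 = 0) (m j : ℕ) :
    ∑ i ∈ Finset.range (4 * m + j), q ^ i = ∑ i ∈ Finset.range j, q ^ i := by
  have hblock : ∑ i ∈ Finset.range (4 * m), q ^ i = 0 := by
    induction m with
    | zero => simp
    | succ m ih =>
      rw [Nat.mul_succ]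
      simp only [Finset.sum_range_succ, ih]
      linear_combination q ^ (4 * m) * hq
  simp [Finset.sum_range_add, hblock, pow_add, pow_mul, pow_four_eq_one_of_geom_sum hq]

lemma IsMarkedPair.step (hq : 1 + q + q ^ 2 + q ^ 3 = 0) {r s : A} (h : IsMarkedPair q r s)
    (e : ℕ) :
    IsMarkedPair q ((∑ i ∈ Finset.range (e + 1), q ^ i) * r - q ^ e * s) r := by
  have hq4 := pow_four_eq_one_of_geom_sum hq
  have hqu := isUnit_of_geom_sum hq
  obtain ⟨u, hu, ⟨rfl, rfl⟩ | ⟨d, rfl, rfl⟩ | ⟨rfl, rfl⟩⟩ := h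
  · exact ⟨r, hu, .inr (.inl ⟨e + 1, by ring, rfl⟩)⟩
  · obtain ⟨m, j, hj, rfl⟩ : ∃ m j, j < 4 ∧ d = 4 * m + j :=
      ⟨d / 4, d % 4, Nat.mod_lt _ (by norm_num), (Nat.div_add_mod d 4).symm⟩
    rw [geom_sum_mod_four hq]
    interval_cases j
    · exact ⟨-(q ^ e * s), ((hqu.pow e).mul hu).neg, .inl ⟨by simp, by simp⟩⟩
    · refine ⟨s, hu, .inr (.inl ⟨e, ?_, by simp⟩)⟩
      simp only [Finset.sum_range_succ, Finset.sum_range_zero]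
      ring
    · obtain ⟨n, k, hk, rfl⟩ : ∃ n k, k < 4 ∧ e = 4 * n + k :=
        ⟨e / 4, e % 4, Nat.mod_lt _ (by norm_num), (Nat.div_add_mod e 4).symm⟩
      have hpow : q ^ (4 * n + k) = q ^ k := by rw [pow_add, pow_mul, hq4, one_pow, one_mul]
      rw [add_assoc, geom_sum_mod_four hq, hpow]
      have hneg : IsUnit (-(q ^ 2 * s)) := ((hqu.pow 2).mul hu).neg
      interval_cases k <;> simp only [Finset.sum_range_succ, Finset.sum_range_zero]
      · exact ⟨s, hu, .inr (.inr ⟨by ring, by ring⟩)⟩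
      · exact ⟨_, hneg, .inr (.inr ⟨by linear_combination s * hq,
          by linear_combination s * hq⟩)⟩
      · exact ⟨s, hu, .inr (.inr ⟨by linear_combination s * hq, by ring⟩)⟩
      · exact ⟨_, hneg, .inr (.inr ⟨by linear_combination s * (1 + q) * hq,
          by linear_combination s * hq⟩)⟩
    · refine ⟨-(q ^ 3 * s), ((hqu.pow 3).mul hu).neg, .inr (.inl ⟨e + 2, ?_, ?_⟩)⟩
      · simp only [Finset.sum_range_succ, Finset.sum_range_zero]
        linear_combination
          s * (∑ i ∈ Finset.range e, q ^ i + q ^ e) * hq + s * q ^ e * hq4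
      · simp only [Finset.sum_range_succ, Finset.sum_range_zero]
        linear_combination s * hq
  · refine ⟨u * q, hu.mul hqu, .inr (.inl ⟨e + 3, ?_, rfl⟩)⟩
    simp only [Finset.sum_range_succ]
    linear_combination -u * q ^ e * hq

end Orbit

lemma Rpoly_cons (c : ℕ) (L : List ℕ) :
    Rpoly (c :: L) = qNat c * Rpoly L - X ^ (c - 1) * Spoly L := by
  simp [Rpoly, Spoly, MqNeg, Matrix.mul_apply, Fin.sum_univ_two, sub_eq_add_neg]

lemma Spoly_cons (c : ℕ) (L : List ℕ) : Spoly (c :: L) = Rpoly L := by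
  simp [Rpoly, Spoly, MqNeg, Matrix.mul_apply, Fin.sum_univ_two]

lemma isMarkedPair_map_Rpoly_Spoly {A : Type*} [CommRing A] (φ : ℤ[X] →+* A)
    (hq : 1 + φ X + φ X ^ 2 + φ X ^ 3 = 0) (L : List ℕ) (hL : ∀ y ∈ L, 1 ≤ y) :
    IsMarkedPair (φ X) (φ (Rpoly L)) (φ (Spoly L)) := by
  induction L with
  | nil => exact ⟨1, isUnit_one, .inl ⟨by simp [Rpoly], by simp [Spoly]⟩⟩
  | cons c L ih =>
    obtain ⟨e, rfl⟩ : ∃ e, c = e + 1 := ⟨c - 1, by have := hL c (by simp); omega⟩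
    simpa [Rpoly_cons, Spoly_cons, qNat] using
      (ih fun y hy => hL y (by simp [hy])).step hq e

lemma qNat_four : qNat 4 = (1 + X) * (X ^ 2 + 1) := by
  simp only [qNat, Finset.sum_range_succ, Finset.sum_range_zero]
  ring

/-- Modulo `[4]_q`, the polynomial `𝓢(c)` is zero, a unit, or a unit times `1 + q`. -/
lemma mk_Spoly_trichotomy (L : List ℕ) (hL : ∀ y ∈ L, 1 ≤ y) :
    qNat 4 ∣ Spoly L ∨ ∃ u, IsUnit u ∧ (AdjoinRoot.mk (qNat 4) (Spoly L) = u ∨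
      AdjoinRoot.mk (qNat 4) (Spoly L) = u * (1 + AdjoinRoot.root (qNat 4))) := by
  have hq : 1 + AdjoinRoot.mk (qNat 4) X + AdjoinRoot.mk (qNat 4) X ^ 2 +
      AdjoinRoot.mk (qNat 4) X ^ 3 = 0 := by
    simpa [Finset.sum_range_succ] using
      (congrArg (AdjoinRoot.mk (qNat 4)) (qNat.eq_1 4)).symm.trans AdjoinRoot.mk_self
  obtain ⟨u, hu, ⟨-, h⟩ | ⟨d, -, h⟩ | ⟨-, h⟩⟩ :=
    isMarkedPair_map_Rpoly_Spoly (AdjoinRoot.mk (qNat 4)) hq L hL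
  · exact .inl (AdjoinRoot.mk_eq_zero.mp h)
  · exact .inr ⟨u, hu, .inl h⟩
  · exact .inr ⟨u, hu, .inr h⟩

/-- A zero of `[4]_q` at which `1 + q` does not vanish detects divisibility of `𝓢(c)` by
`[4]_q`. -/
lemma qNat_four_dvd_Spoly_of_eval₂_eq_zero {B : Type*} [CommRing B] [Nontrivial B] (b : B)
    (hb : (qNat 4).eval₂ (Int.castRingHom B) b = 0) (hb' : 1 + b ≠ 0)
    (L : List ℕ) (hL : ∀ y ∈ L, 1 ≤ y) (h : (Spoly L).eval₂ (Int.castRingHom B) b = 0) :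
    qNat 4 ∣ Spoly L := by
  obtain hS | ⟨u, hu, hS⟩ := mk_Spoly_trichotomy L hL
  · exact hS
  · have hu' := hu.map (AdjoinRoot.lift (Int.castRingHom B) b hb)
    rcases hS with hS | hS <;>
      replace hS := congrArg (AdjoinRoot.lift (Int.castRingHom B) b hb) hS <;>
      simp only [AdjoinRoot.lift_mk, h, map_mul, map_add, map_one, AdjoinRoot.lift_root] at hS
    · exact absurd hS.symm hu'.ne_zero
    · exact absurd (hu'.mul_right_eq_zero.mp hS.symm) hb'

/-- The following are equivalent: `4 ∣ s(L)`; `[4]_q ∣ 𝓢(L)` in `ℤ[q]`;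
`q² + 1 ∣ 𝓢(L)` in `ℤ[q]`. -/
theorem stmt16 (L : List ℕ) (hL : L ≠ []) (hL2 : ∀ y ∈ L, 2 ≤ y) :
    ((4 : ℤ) ∣ sNum L ↔ qNat 4 ∣ Spoly L) ∧
    ((4 : ℤ) ∣ sNum L ↔ (X ^ 2 + 1 : Polynomial ℤ) ∣ Spoly L) := by
  have hL1 : ∀ y ∈ L, 1 ≤ y := fun y hy => (hL2 y hy).trans' (by norm_num)
  have h12 : (4 : ℤ) ∣ sNum L ↔ qNat 4 ∣ Spoly L := by
    constructor
    · intro h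
      have : Fact (1 < 4) := ⟨by norm_num⟩
      refine qNat_four_dvd_Spoly_of_eval₂_eq_zero (1 : ZMod 4) ?_ (by decide) L hL1 ?_
      · simp only [qNat_four, eval₂_mul, eval₂_add, eval₂_pow, eval₂_X, eval₂_one]
        rfl
      · rw [← map_one (Int.castRingHom (ZMod 4)), eval₂_at_apply]
        exact (ZMod.intCast_zmod_eq_zero_iff_dvd _ 4).mpr h
    · intro h
      simpa [sNum, qNat] using eval_dvd (x := 1) h
  refine ⟨h12, h12.trans ⟨(Dvd.intro_left _ qNat_four.symm).trans, ?_⟩⟩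
  rintro ⟨p, hp⟩
  have hi : (⟨0, 1⟩ : GaussianInt) ^ 2 + 1 = 0 := by decide
  refine qNat_four_dvd_Spoly_of_eval₂_eq_zero (⟨0, 1⟩ : GaussianInt) ?_ (by decide) L hL1 ?_
  · simp [qNat_four, eval₂_mul, hi]
  · simp [hp, eval₂_mul, hi]
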